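/- Let h₁, g₁, h₂, g₂ : D^I_{2,2} → ℂ be holomorphic functions such that |h_j(W)| < 1 and |g_j(W)| < 1 for all W ∈ D^I_{2,2} and j = 1,2. Define f : D^I_{2,2} × D^I_{2,2} → M(3,3;ℂ) × M(3,3;ℂ) by f(Z¹,Z²) = ( [[Z¹,0],[0, h₁(Z²)g₁(Z¹)]], [[Z²,0],[0, h₂(Z¹)g₂(Z²)]] ), where each component is the 3×3 block-diagonal matrix with a 2×2 block and a 1×1 block. Then f is a proper holomorphic map from D^I_{2,2} × D^I_{2,2} to D^I_{3,3} × D^I_{3,3}: f is holomorphic, its image is contained in D^I_{3,3} × D^I_{3,3}, and, with the subspace topologies, the preimage under f of every compact subset of D^I_{3,3} × D^I_{3,3} is compact. -/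

import Mathlib

open Matrix
open scoped ComplexOrder

attribute [local instance] Matrix.normedAddCommGroup Matrix.normedSpace

/-- The type-I bounded symmetric domain
`D^I_{p,q} = {Z ∈ M(p,q;ℂ) : I_q − ZᴴZ > 0}`. -/
def typeIDomain (p q : ℕ) : Set (Matrix (Fin p) (Fin q) ℂ) :=
  {Z | (1 - Zᴴ * Z).PosDef}

/-- The block-diagonal matrix `[[A,0],[0,B]]` as a `(p₁+p₂) × (q₁+q₂)` matrix. -/
def blockDiagMat {p₁ q₁ p₂ q₂ : ℕ}
    (A : Matrix (Fin p₁) (Fin q₁) ℂ) (B : Matrix (Fin p₂) (Fin q₂) ℂ) :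
    Matrix (Fin (p₁ + p₂)) (Fin (q₁ + q₂)) ℂ :=
  Matrix.reindex finSumFinEquiv finSumFinEquiv (Matrix.fromBlocks A 0 0 B)

/-- A block-diagonal matrix is positive definite iff its diagonal blocks are. -/
theorem posDef_fromBlocks_zero_iff {m n : Type*} [Fintype m] [Fintype n]
    {A : Matrix m m ℂ} {D : Matrix n n ℂ} :
    (Matrix.fromBlocks A 0 0 D).PosDef ↔ A.PosDef ∧ D.PosDef := by
  constructor
  · intro h
    exact ⟨h.submatrix Sum.inl_injective, h.submatrix Sum.inr_injective⟩
  · rintro ⟨hA, hD⟩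
    refine Matrix.PosDef.of_dotProduct_mulVec_pos
      (Matrix.IsHermitian.fromBlocks hA.isHermitian (by simp) hD.isHermitian) fun x hx => ?_
    obtain ⟨u, v, rfl⟩ : ∃ u v, x = Sum.elim u v :=
      ⟨x ∘ Sum.inl, x ∘ Sum.inr, (Sum.elim_comp_inl_inr x).symm⟩
    have hstar : star (Sum.elim u v) = Sum.elim (star u) (star v) := by
      ext i; cases i <;> rfl
    rw [Matrix.fromBlocks_mulVec, hstar, sumElim_dotProduct_sumElim]
    simp only [Sum.elim_comp_inl, Sum.elim_comp_inr, Matrix.zero_mulVec, add_zero, zero_add]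
    by_cases hu : u = 0
    · have hv : v ≠ 0 := by
        rintro rfl
        exact hx (by subst hu; ext i; cases i <;> rfl)
      simpa [hu] using hD.dotProduct_mulVec_pos hv
    · exact add_pos_of_pos_of_nonneg (hA.dotProduct_mulVec_pos hu)
        (hD.posSemidef.dotProduct_mulVec_nonneg v)

theorem blockDiagMat_mem_typeIDomain_iff {p₁ q₁ p₂ q₂ : ℕ}
    {A : Matrix (Fin p₁) (Fin q₁) ℂ} {B : Matrix (Fin p₂) (Fin q₂) ℂ} :
    blockDiagMat A B ∈ typeIDomain (p₁ + p₂) (q₁ + q₂) ↔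
      A ∈ typeIDomain p₁ q₁ ∧ B ∈ typeIDomain p₂ q₂ := by
  have key : 1 - (blockDiagMat A B)ᴴ * blockDiagMat A B =
      (Matrix.fromBlocks (1 - Aᴴ * A) 0 0 (1 - Bᴴ * B)).submatrix
        finSumFinEquiv.symm finSumFinEquiv.symm := by
    have h : Matrix.fromBlocks (1 - Aᴴ * A) 0 0 (1 - Bᴴ * B) =
        1 - (Matrix.fromBlocks A 0 0 B)ᴴ * Matrix.fromBlocks A 0 0 B := by
      rw [← Matrix.fromBlocks_one, Matrix.fromBlocks_conjTranspose, Matrix.fromBlocks_multiply]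
      simp [sub_eq_add_neg, Matrix.fromBlocks_neg, Matrix.fromBlocks_add, -Matrix.fromBlocks_one]
    rw [h, Matrix.submatrix_sub, Pi.sub_apply, Pi.sub_apply, Matrix.submatrix_one_equiv,
      blockDiagMat, Matrix.reindex_apply, Matrix.conjTranspose_submatrix,
      Matrix.submatrix_mul_equiv]
  simp only [typeIDomain, Set.mem_ofPred_eq, key, ← posDef_fromBlocks_zero_iff]
  constructor
  · intro h
    simpa using h.submatrix finSumFinEquiv.injective
  · intro h
    exact h.submatrix finSumFinEquiv.symm.injective

theorem of_const_mem_typeIDomain {c : ℂ} (hc : ‖c‖ < 1) :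
    (Matrix.of fun _ _ : Fin 1 => c) ∈ typeIDomain 1 1 := by
  have h : (1 : Matrix (Fin 1) (Fin 1) ℂ) -
      (Matrix.of fun _ _ : Fin 1 => c)ᴴ * (Matrix.of fun _ _ : Fin 1 => c) =
      Matrix.diagonal fun _ => ((1 - ‖c‖ ^ 2 : ℝ) : ℂ) := by
    ext i j
    fin_cases i; fin_cases j
    simp [Matrix.mul_apply, Complex.conj_mul']
  change Matrix.PosDef _
  rw [h, Matrix.posDef_diagonal_iff]
  intro _
  have : ‖c‖ ^ 2 < 1 := by nlinarith [norm_nonneg c]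
  exact_mod_cast sub_pos.mpr this

/-- The block-diagonal embedding as a continuous linear map. -/
noncomputable def blockDiagMatCLM (p₁ q₁ p₂ q₂ : ℕ) :
    Matrix (Fin p₁) (Fin q₁) ℂ × Matrix (Fin p₂) (Fin q₂) ℂ →L[ℂ]
      Matrix (Fin (p₁ + p₂)) (Fin (q₁ + q₂)) ℂ :=
  LinearMap.toContinuousLinearMap
    { toFun := fun X => blockDiagMat X.1 X.2
      map_add' := fun X Y => by
        rw [blockDiagMat, blockDiagMat, blockDiagMat, Prod.fst_add, Prod.snd_add,
          ← add_zero (0 : Matrix (Fin p₁) (Fin q₂) ℂ), ← add_zero (0 : Matrix (Fin p₂) (Fin q₁) ℂ),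
          ← Matrix.fromBlocks_add]
        simp [Matrix.submatrix_add]
      map_smul' := fun c X => by
        rw [blockDiagMat, blockDiagMat, Prod.smul_fst, Prod.smul_snd,
          ← smul_zero (A := Matrix (Fin p₁) (Fin q₂) ℂ) c,
          ← smul_zero (A := Matrix (Fin p₂) (Fin q₁) ℂ) c, ← Matrix.fromBlocks_smul]
        simp [Matrix.submatrix_smul] }

/-- The upper-left block of a matrix. -/
def upperLeft {p₁ q₁ p₂ q₂ : ℕ} (W : Matrix (Fin (p₁ + p₂)) (Fin (q₁ + q₂)) ℂ) :
    Matrix (Fin p₁) (Fin q₁) ℂ :=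
  W.submatrix (Fin.castAdd p₂) (Fin.castAdd q₂)

/-- The lower-right block of a matrix. -/
def lowerRight {p₁ q₁ p₂ q₂ : ℕ} (W : Matrix (Fin (p₁ + p₂)) (Fin (q₁ + q₂)) ℂ) :
    Matrix (Fin p₂) (Fin q₂) ℂ :=
  W.submatrix (Fin.natAdd p₁) (Fin.natAdd q₁)

theorem upperLeft_blockDiagMat {p₁ q₁ p₂ q₂ : ℕ}
    (A : Matrix (Fin p₁) (Fin q₁) ℂ) (B : Matrix (Fin p₂) (Fin q₂) ℂ) :
    upperLeft (blockDiagMat A B) = A := by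
  ext i j; simp [upperLeft, blockDiagMat]

theorem lowerRight_blockDiagMat {p₁ q₁ p₂ q₂ : ℕ}
    (A : Matrix (Fin p₁) (Fin q₁) ℂ) (B : Matrix (Fin p₂) (Fin q₂) ℂ) :
    lowerRight (blockDiagMat A B) = B := by
  ext i j; simp [lowerRight, blockDiagMat]

theorem continuous_upperLeft {p₁ q₁ p₂ q₂ : ℕ} :
    Continuous (upperLeft : Matrix (Fin (p₁ + p₂)) (Fin (q₁ + q₂)) ℂ → _) :=
  continuous_id.matrix_submatrix _ _

theorem continuous_lowerRight {p₁ q₁ p₂ q₂ : ℕ} :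
    Continuous (lowerRight : Matrix (Fin (p₁ + p₂)) (Fin (q₁ + q₂)) ℂ → _) :=
  continuous_id.matrix_submatrix _ _

/-- The upper-left blocks of the block-diagonal members of a compact subset of
`typeIDomain (p₁ + p₂) (q₁ + q₂)` squared form a compact subset of `typeIDomain p₁ q₁` squared. -/
theorem exists_isCompact_upperLeft {p₁ q₁ p₂ q₂ : ℕ}
    {K : Set (Matrix (Fin (p₁ + p₂)) (Fin (q₁ + q₂)) ℂ ×
      Matrix (Fin (p₁ + p₂)) (Fin (q₁ + q₂)) ℂ)}
    (hK : K ⊆ typeIDomain (p₁ + p₂) (q₁ + q₂) ×ˢ typeIDomain (p₁ + p₂) (q₁ + q₂))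
    (hKc : IsCompact K) :
    ∃ L : Set (Matrix (Fin p₁) (Fin q₁) ℂ × Matrix (Fin p₁) (Fin q₁) ℂ),
      IsCompact L ∧ L ⊆ typeIDomain p₁ q₁ ×ˢ typeIDomain p₁ q₁ ∧
      ∀ A A' B B', (blockDiagMat A B, blockDiagMat A' B') ∈ K → (A, A') ∈ L := by
  have hr : Continuous fun W : Matrix (Fin (p₁ + p₂)) (Fin (q₁ + q₂)) ℂ =>
      blockDiagMat (upperLeft W : Matrix (Fin p₁) (Fin q₁) ℂ) (lowerRight W) :=
    (blockDiagMatCLM p₁ q₁ p₂ q₂).continuous.comp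
      (continuous_upperLeft.prodMk continuous_lowerRight)
  have hcl : IsClosed {W : Matrix (Fin (p₁ + p₂)) (Fin (q₁ + q₂)) ℂ |
      blockDiagMat (upperLeft W : Matrix (Fin p₁) (Fin q₁) ℂ) (lowerRight W) = W} :=
    isClosed_eq hr continuous_id
  refine ⟨Prod.map upperLeft upperLeft '' (K ∩ _ ×ˢ _),
    (hKc.inter_right (hcl.prod hcl)).image
      (continuous_upperLeft.prodMap continuous_upperLeft), ?_, fun A A' B B' h => ?_⟩
  · rintro _ ⟨W, ⟨hW, h₁, h₂⟩, rfl⟩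
    have hW' := hK hW
    rw [Set.mem_prod, ← Set.mem_ofPred_eq.mp h₁, ← Set.mem_ofPred_eq.mp h₂] at hW'
    exact ⟨(blockDiagMat_mem_typeIDomain_iff.mp hW'.1).1,
      (blockDiagMat_mem_typeIDomain_iff.mp hW'.2).1⟩
  · refine ⟨_, ⟨h, ?_, ?_⟩, ?_⟩
    · simp [upperLeft_blockDiagMat, lowerRight_blockDiagMat]
    · simp [upperLeft_blockDiagMat, lowerRight_blockDiagMat]
    · simp [upperLeft_blockDiagMat]

theorem differentiableOn_blockDiagMat_of_const {E : Type*} [NormedAddCommGroup E]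
    [NormedSpace ℂ E] {p q : ℕ} {s : Set E} {A : E → Matrix (Fin p) (Fin q) ℂ} {c : E → ℂ}
    (hA : DifferentiableOn ℂ A s) (hc : DifferentiableOn ℂ c s) :
    DifferentiableOn ℂ (fun x => blockDiagMat (A x) (Matrix.of fun _ _ : Fin 1 => c x)) s :=
  (blockDiagMatCLM p q 1 1).differentiable.comp_differentiableOn
    (hA.prodMk (differentiableOn_pi.mpr fun _ => differentiableOn_pi.mpr fun _ => hc))

/-- If `h₁,g₁,h₂,g₂` are holomorphic on `D^I_{2,2}` with modulus `< 1` there, then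
`f(Z¹,Z²) = ([[Z¹,0],[0,h₁(Z²)g₁(Z¹)]], [[Z²,0],[0,h₂(Z¹)g₂(Z²)]])` is a proper
holomorphic map from `D^I_{2,2} × D^I_{2,2}` to `D^I_{3,3} × D^I_{3,3}`. -/
theorem semiProduct_proper_holomorphic
    (h₁ g₁ h₂ g₂ : Matrix (Fin 2) (Fin 2) ℂ → ℂ)
    (hh₁ : DifferentiableOn ℂ h₁ (typeIDomain 2 2))
    (hg₁ : DifferentiableOn ℂ g₁ (typeIDomain 2 2))
    (hh₂ : DifferentiableOn ℂ h₂ (typeIDomain 2 2))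
    (hg₂ : DifferentiableOn ℂ g₂ (typeIDomain 2 2))
    (hh₁1 : ∀ W ∈ typeIDomain 2 2, ‖h₁ W‖ < 1)
    (hg₁1 : ∀ W ∈ typeIDomain 2 2, ‖g₁ W‖ < 1)
    (hh₂1 : ∀ W ∈ typeIDomain 2 2, ‖h₂ W‖ < 1)
    (hg₂1 : ∀ W ∈ typeIDomain 2 2, ‖g₂ W‖ < 1) :
    DifferentiableOn ℂ
      (fun Z : Matrix (Fin 2) (Fin 2) ℂ × Matrix (Fin 2) (Fin 2) ℂ =>
        (blockDiagMat Z.1 (Matrix.of fun _ _ : Fin 1 => h₁ Z.2 * g₁ Z.1),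
         blockDiagMat Z.2 (Matrix.of fun _ _ : Fin 1 => h₂ Z.1 * g₂ Z.2)))
      (typeIDomain 2 2 ×ˢ typeIDomain 2 2) ∧
    Set.MapsTo
      (fun Z : Matrix (Fin 2) (Fin 2) ℂ × Matrix (Fin 2) (Fin 2) ℂ =>
        (blockDiagMat Z.1 (Matrix.of fun _ _ : Fin 1 => h₁ Z.2 * g₁ Z.1),
         blockDiagMat Z.2 (Matrix.of fun _ _ : Fin 1 => h₂ Z.1 * g₂ Z.2)))
      (typeIDomain 2 2 ×ˢ typeIDomain 2 2) (typeIDomain 3 3 ×ˢ typeIDomain 3 3) ∧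
    ∀ K : Set (Matrix (Fin 3) (Fin 3) ℂ × Matrix (Fin 3) (Fin 3) ℂ),
      K ⊆ typeIDomain 3 3 ×ˢ typeIDomain 3 3 → IsCompact K →
      IsCompact
        ((fun Z : Matrix (Fin 2) (Fin 2) ℂ × Matrix (Fin 2) (Fin 2) ℂ =>
          (blockDiagMat Z.1 (Matrix.of fun _ _ : Fin 1 => h₁ Z.2 * g₁ Z.1),
           blockDiagMat Z.2 (Matrix.of fun _ _ : Fin 1 => h₂ Z.1 * g₂ Z.2))) ⁻¹' K ∩
          (typeIDomain 2 2 ×ˢ typeIDomain 2 2)) := by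
  have hfst : Set.MapsTo Prod.fst (typeIDomain 2 2 ×ˢ typeIDomain 2 2) (typeIDomain 2 2) :=
    fun _ h => h.1
  have hsnd : Set.MapsTo Prod.snd (typeIDomain 2 2 ×ˢ typeIDomain 2 2) (typeIDomain 2 2) :=
    fun _ h => h.2
  have mul_lt {a b : ℂ} (ha : ‖a‖ < 1) (hb : ‖b‖ < 1) : ‖a * b‖ < 1 := by
    rw [norm_mul]
    exact mul_lt_one_of_nonneg_of_lt_one_left (norm_nonneg _) ha hb.le
  have hdiff := (differentiableOn_blockDiagMat_of_const differentiableOn_fst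
    ((hh₁.comp differentiableOn_snd hsnd).mul (hg₁.comp differentiableOn_fst hfst))).prodMk
    (differentiableOn_blockDiagMat_of_const differentiableOn_snd
      ((hh₂.comp differentiableOn_fst hfst).mul (hg₂.comp differentiableOn_snd hsnd)))
  refine ⟨hdiff, fun Z hZ => ⟨?_, ?_⟩, fun K hK hKc => ?_⟩
  · exact blockDiagMat_mem_typeIDomain_iff.mpr ⟨hZ.1,
      of_const_mem_typeIDomain (mul_lt (hh₁1 _ hZ.2) (hg₁1 _ hZ.1))⟩
  · exact blockDiagMat_mem_typeIDomain_iff.mpr ⟨hZ.2,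
      of_const_mem_typeIDomain (mul_lt (hh₂1 _ hZ.1) (hg₂1 _ hZ.2))⟩
  · obtain ⟨L, hLc, hL, hKL⟩ :=
      exists_isCompact_upperLeft (p₁ := 2) (q₁ := 2) (p₂ := 1) (q₂ := 1) hK hKc
    refine hLc.of_isClosed_subset (s := L) ?_ fun Z hZ => hKL _ _ _ _ hZ.1
    have hS := (hdiff.continuousOn.mono hL).preimage_isClosed_of_isClosed hLc.isClosed
      hKc.isClosed
    refine (congrArg IsClosed ?_).mpr hS
    exact Set.Subset.antisymm (fun Z h => ⟨hKL _ _ _ _ h.1, h.1⟩) fun Z h => ⟨h.2, hL h.1⟩
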